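/- For every τ ∈ K one has sup{ξ : τ − g(ξ) | ξ ∈ 𝕄²ˣ²_sym} = (1/2)(ℂ⁻¹τ) : τ, while for every τ ∉ K the set {ξ : τ − g(ξ) | ξ ∈ 𝕄²ˣ²_sym} is not bounded above; that is, the Fenchel conjugate of g equals τ ↦ (1/2)(ℂ⁻¹τ):τ + I_K(τ), where I_K is the indicator function of K. -/

import Mathlib

open Matrix Set
open scoped Classical

attribute [local instance] Matrix.frobeniusNormedAddCommGroup Matrix.frobeniusNormedSpace

noncomputable section

/-- The space of real 2×2 matrices (symmetric ones are singled out by `Matrix.IsSymm`). -/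
abbrev M2 : Type := Matrix (Fin 2) (Fin 2) ℝ

/-- Frobenius inner product `A : B = tr (Aᵀ B)`. -/
def inn (A B : M2) : ℝ := (Aᵀ * B).trace

/-- Frobenius norm `|A| = √(A : A)`. -/
def fnorm (A : M2) : ℝ := Real.sqrt (inn A A)

/-- Deviatoric part `A_D = A − (tr A / 2) Id`. -/
def dev (A : M2) : M2 := A - (A.trace / 2) • (1 : M2)

/-- The set of symmetric matrices `𝕄²ˣ²_sym`. -/
def Msym : Set M2 := {A | A.IsSymm}

/-- The Drucker–Prager elasticity set `K = {σ ∈ 𝕄²ˣ²_sym : |σ_D| + α tr σ ≤ κ}`. -/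
def Kset (α κ : ℝ) : Set M2 :=
  {σ | σ.IsSymm ∧ fnorm (dev σ) + α * σ.trace ≤ κ}

/-- The isotropic elasticity tensor `ℂ e = λ (tr e) Id + 2 μ e`. -/
def Cc (lam mu : ℝ) (e : M2) : M2 := (lam * e.trace) • (1 : M2) + (2 * mu) • e

/-- The inverse elasticity tensor `ℂ⁻¹ σ = (tr σ / (4 K₀)) Id + (1/(2μ)) σ_D`, `K₀ = λ + μ`. -/
def Cinv (lam mu : ℝ) (σ : M2) : M2 :=
  (σ.trace / (4 * (lam + mu))) • (1 : M2) + (1 / (2 * mu)) • dev σ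

/-- The constant `β = (1/μ + 1/(2 α² K₀))⁻¹`. -/
def betaC (α lam mu : ℝ) : ℝ := (1 / mu + 1 / (2 * α ^ 2 * (lam + mu)))⁻¹

/-- The function `g`. -/
def gfun (α κ lam mu : ℝ) (ξ : M2) : ℝ :=
  if 2 * mu * fnorm (dev ξ) + 2 * α * (lam + mu) * ξ.trace ≤ κ then
    ((lam + mu) / 2) * ξ.trace ^ 2 + mu * fnorm (dev ξ) ^ 2
  else
    κ * ξ.trace / (2 * α) - κ ^ 2 / (8 * α ^ 2 * (lam + mu)) +
      betaC α lam mu *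
        max (fnorm (dev ξ) - ξ.trace / (2 * α) + κ / (4 * α ^ 2 * (lam + mu))) 0 ^ 2

/-- The (matrix representing the) differential of `g`. -/
def Dg (α κ lam mu : ℝ) (ξ : M2) : M2 :=
  if 2 * mu * fnorm (dev ξ) + 2 * α * (lam + mu) * ξ.trace ≤ κ then
    ((lam + mu) * ξ.trace) • (1 : M2) + (2 * mu) • dev ξ
  else
    (κ / (2 * α)) • (1 : M2) +
      (2 * betaC α lam mu *
          max (fnorm (dev ξ) - ξ.trace / (2 * α) + κ / (4 * α ^ 2 * (lam + mu))) 0) •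
        ((fnorm (dev ξ))⁻¹ • dev ξ - (1 / (2 * α)) • (1 : M2))

/-- The open cone `𝒜₁ = {ξ ∈ 𝕄²ˣ²_sym : μ |ξ_D| + α K₀ tr ξ < 0}`. -/
def A1 (α lam mu : ℝ) : Set M2 :=
  {ξ | ξ.IsSymm ∧ mu * fnorm (dev ξ) + α * (lam + mu) * ξ.trace < 0}

/-- The open cone `𝒜₂ = {ξ ∈ 𝕄²ˣ²_sym : |ξ_D| < tr ξ / (2α)}`. -/
def A2 (α : ℝ) : Set M2 :=
  {ξ | ξ.IsSymm ∧ fnorm (dev ξ) < ξ.trace / (2 * α)}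

/-- The cone `𝒜₃ = 𝕄²ˣ²_sym ∖ (cl 𝒜₁ ∪ cl 𝒜₂)`. -/
def A3 (α lam mu : ℝ) : Set M2 :=
  Msym \ (closure (A1 α lam mu) ∪ closure (A2 α))

/-- The function `G(ξ) = Dg(ξ + (κ/(4αK₀)) Id)`, given by its explicit piecewise expression. -/
def Gfun (α κ lam mu : ℝ) (ξ : M2) : M2 :=
  if ξ ∈ A1 α lam mu then
    (κ / (2 * α)) • (1 : M2) + ((lam + mu) * ξ.trace) • (1 : M2) + (2 * mu) • dev ξ
  else if ξ ∈ A2 α ∨ ξ = 0 then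
    (κ / (2 * α)) • (1 : M2)
  else
    (κ / (2 * α)) • (1 : M2) +
      (2 * betaC α lam mu * (fnorm (dev ξ) - ξ.trace / (2 * α))) •
        ((fnorm (dev ξ))⁻¹ • dev ξ - (1 / (2 * α)) • (1 : M2))

/-- The map `𝒢(ξ, η)`. -/
def calG (α lam mu : ℝ) (ξ η : M2) : M2 :=
  if ξ ∈ A1 α lam mu then
    ((lam + mu) * η.trace) • (1 : M2) + (2 * mu) • dev η
  else if ξ ∈ A2 α ∨ ξ = 0 then
    0
  else
    (2 * betaC α lam mu * (inn (dev ξ) (dev η) / fnorm (dev ξ) - η.trace / (2 * α))) •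
      ((fnorm (dev ξ))⁻¹ • dev ξ - (1 / (2 * α)) • (1 : M2)) +
    (2 * betaC α lam mu * (fnorm (dev ξ) - ξ.trace / (2 * α)) * (fnorm (dev ξ))⁻¹) •
      (dev η - (inn (dev ξ) (dev η) / fnorm (dev ξ) ^ 2) • dev ξ)

/-- The relative boundary `∂𝒜₁` of `𝒜₁` inside `𝕄²ˣ²_sym`. -/
def bdryA1 (α lam mu : ℝ) : Set M2 := closure (A1 α lam mu) \ A1 α lam mu

/-- The relative boundary `∂𝒜₂` of `𝒜₂` inside `𝕄²ˣ²_sym`. -/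
def bdryA2 (α : ℝ) : Set M2 := closure (A2 α) \ A2 α

/-- The outward normal `ν(σ) = μ σ_D/|σ_D| + α K₀ Id` for `σ ∈ ∂𝒜₁ ∖ {0}`. -/
def nu1 (α lam mu : ℝ) (σ : M2) : M2 :=
  (mu * (fnorm (dev σ))⁻¹) • dev σ + (α * (lam + mu)) • (1 : M2)

/-- The outward normal `ν(σ) = σ_D/|σ_D| − (1/(2α)) Id` for `σ ∈ ∂𝒜₂ ∖ {0}`. -/
def nu2 (α : ℝ) (σ : M2) : M2 :=
  (fnorm (dev σ))⁻¹ • dev σ - (1 / (2 * α)) • (1 : M2)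

theorem inn_apply (A B : M2) :
    inn A B = A 0 0 * B 0 0 + A 1 0 * B 1 0 + (A 0 1 * B 0 1 + A 1 1 * B 1 1) := by
  simp [inn, Matrix.trace, Matrix.mul_apply, Fin.sum_univ_two]

theorem inn_self_nonneg (A : M2) : 0 ≤ inn A A := by
  rw [inn_apply]
  nlinarith [sq_nonneg (A 0 0), sq_nonneg (A 1 0), sq_nonneg (A 0 1), sq_nonneg (A 1 1)]

theorem fnorm_nonneg (A : M2) : 0 ≤ fnorm A := Real.sqrt_nonneg _

theorem fnorm_sq (A : M2) : fnorm A ^ 2 = inn A A := Real.sq_sqrt (inn_self_nonneg A)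

theorem fnorm_smul (c : ℝ) (A : M2) : fnorm (c • A) = |c| * fnorm A := by
  have h : inn (c • A) (c • A) = c ^ 2 * inn A A := by
    simp only [inn_apply, Matrix.smul_apply, smul_eq_mul]
    ring
  rw [fnorm, fnorm, h, Real.sqrt_mul (sq_nonneg c), Real.sqrt_sq_eq_abs]

/-- Cauchy–Schwarz inequality for the Frobenius inner product. -/
theorem inn_le_fnorm_mul_fnorm (A B : M2) : inn A B ≤ fnorm A * fnorm B := by
  rw [fnorm, fnorm, ← Real.sqrt_mul (inn_self_nonneg A)]
  refine (le_abs_self _).trans (Real.abs_le_sqrt ?_)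
  simp only [inn_apply]
  nlinarith [sq_nonneg (A 0 0 * B 1 0 - A 1 0 * B 0 0), sq_nonneg (A 0 0 * B 0 1 - A 0 1 * B 0 0),
    sq_nonneg (A 0 0 * B 1 1 - A 1 1 * B 0 0), sq_nonneg (A 1 0 * B 0 1 - A 0 1 * B 1 0),
    sq_nonneg (A 1 0 * B 1 1 - A 1 1 * B 1 0), sq_nonneg (A 0 1 * B 1 1 - A 1 1 * B 0 1)]

theorem trace_smul_one_add_smul_dev (a b : ℝ) (A : M2) :
    (a • (1 : M2) + b • dev A).trace = 2 * a := by
  simp [dev, Matrix.trace, Fin.sum_univ_two]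
  ring

theorem dev_smul_one_add_smul_dev (a b : ℝ) (A : M2) :
    dev (a • (1 : M2) + b • dev A) = b • dev A := by
  rw [dev, trace_smul_one_add_smul_dev, mul_div_cancel_left₀ _ two_ne_zero, add_sub_cancel_left]

theorem isSymm_smul_one_add_smul_dev (a b : ℝ) {A : M2} (hA : A.IsSymm) :
    (a • (1 : M2) + b • dev A).IsSymm :=
  (Matrix.isSymm_one.smul a).add ((hA.sub (Matrix.isSymm_one.smul _)).smul b)

theorem inn_eq_inn_dev_add (A B : M2) :
    inn A B = inn (dev A) (dev B) + A.trace * B.trace / 2 := by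
  simp [inn_apply, dev, Matrix.trace, Fin.sum_univ_two]
  ring

theorem inn_smul_one_add_smul_dev (a b : ℝ) (A : M2) :
    inn (a • (1 : M2) + b • dev A) A = a * A.trace + b * fnorm (dev A) ^ 2 := by
  rw [inn_eq_inn_dev_add, dev_smul_one_add_smul_dev, trace_smul_one_add_smul_dev, fnorm_sq]
  simp only [inn_apply, Matrix.smul_apply, smul_eq_mul]
  ring

theorem mul_sub_mul_sq_le {a : ℝ} (ha : 0 < a) (x y : ℝ) : x * y - a * x ^ 2 ≤ y ^ 2 / (4 * a) := by
  rw [le_div_iff₀ (by positivity)]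
  nlinarith [sq_nonneg (2 * a * x - y)]

/-- Young-type inequality governing the plastic branch of `g`. -/
theorem mul_sub_mul_sub_sq_posPart_le {A B x z d r : ℝ} (hA : 0 < A) (hB : 0 < B) (hd : 0 ≤ d)
    (hdr : d ≤ r) (hxz : 0 ≤ B * x + A * z) :
    x * d - r * z - (A + B)⁻¹ * max (x - z) 0 ^ 2 ≤ (A * d ^ 2 + B * r ^ 2) / 4 := by
  rcases le_total 0 z with hz | hz
  · have hle : x * d - r * z ≤ max (x - z) 0 * d := by
      nlinarith [mul_le_mul_of_nonneg_right (le_max_left (x - z) 0) hd,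
        mul_le_mul_of_nonneg_right hdr hz]
    have hyoung := mul_sub_mul_sq_le (inv_pos.2 (add_pos hA hB)) (max (x - z) 0) d
    have heq : d ^ 2 / (4 * (A + B)⁻¹) = (A + B) * d ^ 2 / 4 := by field_simp
    rw [heq] at hyoung
    nlinarith [mul_le_mul_of_nonneg_left (pow_le_pow_left₀ hd hdr 2) hB.le]
  · have hx : z ≤ x := by nlinarith
    rw [max_eq_left (sub_nonneg.2 hx)]
    have hkey : (A * d ^ 2 + B * r ^ 2) / 4 - (x * d - r * z - (A + B)⁻¹ * (x - z) ^ 2) =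
        A * (d / 2 - (x - z) / (A + B)) ^ 2 + B * (r / 2 - (x - z) / (A + B)) ^ 2 +
          (r - d) * ((B * x + A * z) / (A + B)) := by
      field_simp
      ring
    have hcross : 0 ≤ (r - d) * ((B * x + A * z) / (A + B)) :=
      mul_nonneg (sub_nonneg.2 hdr) (div_nonneg hxz (add_pos hA hB).le)
    nlinarith [mul_nonneg hA.le (sq_nonneg (d / 2 - (x - z) / (A + B))),
      mul_nonneg hB.le (sq_nonneg (r / 2 - (x - z) / (A + B)))]

theorem half_inn_Cinv (lam mu : ℝ) (τ : M2) :
    (1 / 2) * inn (Cinv lam mu τ) τ =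
      τ.trace ^ 2 / (8 * (lam + mu)) + fnorm (dev τ) ^ 2 / (4 * mu) := by
  rw [Cinv, inn_smul_one_add_smul_dev]
  generalize lam + mu = K
  ring

/-- Fenchel–Young inequality for `g` on the elasticity set. -/
theorem inn_sub_gfun_le {α κ lam mu : ℝ} (hα : 0 < α) (hmu : 0 < mu) (hlm : 0 < lam + mu)
    {τ : M2} (hτ : fnorm (dev τ) + α * τ.trace ≤ κ) (ξ : M2) :
    inn ξ τ - gfun α κ lam mu ξ ≤ (1 / 2) * inn (Cinv lam mu τ) τ := by
  rw [half_inn_Cinv, inn_eq_inn_dev_add]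
  have hcs := inn_le_fnorm_mul_fnorm (dev ξ) (dev τ)
  have hd := fnorm_nonneg (dev τ)
  rw [gfun, betaC]
  generalize inn (dev ξ) (dev τ) = i at *
  generalize fnorm (dev ξ) = x at *
  generalize fnorm (dev τ) = d at *
  generalize ξ.trace = t at *
  generalize τ.trace = s at *
  generalize lam + mu = K at *
  split_ifs with h
  · have h₁ := mul_sub_mul_sq_le hmu x d
    have h₂ := mul_sub_mul_sq_le (half_pos hlm) t (s / 2)
    have heq : (s / 2) ^ 2 / (4 * (K / 2)) = s ^ 2 / (8 * K) := by
      field_simp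
      ring
    rw [heq] at h₂
    linarith
  · have hxz : 0 ≤ 1 / (2 * α ^ 2 * K) * x + 1 / mu * (t / (2 * α) - κ / (4 * α ^ 2 * K)) := by
      have heq : 1 / (2 * α ^ 2 * K) * x + 1 / mu * (t / (2 * α) - κ / (4 * α ^ 2 * K)) =
          (2 * mu * x + 2 * α * K * t - κ) / (4 * α ^ 2 * K * mu) := by
        field_simp
        ring
      rw [heq]
      exact div_nonneg (by linarith) (by positivity)
    have hmain := mul_sub_mul_sub_sq_posPart_le (one_div_pos.2 hmu)
      (show 0 < 1 / (2 * α ^ 2 * K) by positivity) hd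
      (show d ≤ κ - α * s by linarith) hxz
    rw [← sub_add] at hmain
    have heq : (κ - α * s) * (t / (2 * α) - κ / (4 * α ^ 2 * K)) =
        κ * t / (2 * α) - κ ^ 2 / (8 * α ^ 2 * K) - t * s / 2 - κ ^ 2 / (8 * α ^ 2 * K)
          + κ * s / (4 * α * K) := by
      field_simp
      ring
    have heq' : (1 / mu * d ^ 2 + 1 / (2 * α ^ 2 * K) * (κ - α * s) ^ 2) / 4 =
        s ^ 2 / (8 * K) + d ^ 2 / (4 * mu) + κ ^ 2 / (8 * α ^ 2 * K) - κ * s / (4 * α * K) := by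
      field_simp
      ring
    rw [heq, heq'] at hmain
    linarith

/-- On the elasticity set, equality in the Fenchel–Young inequality holds at `ℂ⁻¹ τ`. -/
theorem inn_Cinv_sub_gfun_Cinv {α κ lam mu : ℝ} (hmu : 0 < mu) (hlm : 0 < lam + mu)
    {τ : M2} (hτ : fnorm (dev τ) + α * τ.trace ≤ κ) :
    inn (Cinv lam mu τ) τ - gfun α κ lam mu (Cinv lam mu τ) =
      (1 / 2) * inn (Cinv lam mu τ) τ := by
  have htr : (Cinv lam mu τ).trace = τ.trace / (2 * (lam + mu)) := by
    rw [Cinv, trace_smul_one_add_smul_dev]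
    field_simp
    ring
  have hdev : fnorm (dev (Cinv lam mu τ)) = fnorm (dev τ) / (2 * mu) := by
    rw [Cinv, dev_smul_one_add_smul_dev, fnorm_smul, abs_of_pos (by positivity)]
    ring
  have hbranch : 2 * mu * (fnorm (dev τ) / (2 * mu)) +
      2 * α * (lam + mu) * (τ.trace / (2 * (lam + mu))) = fnorm (dev τ) + α * τ.trace := by
    field_simp
  have hhalf := half_inn_Cinv lam mu τ
  have hval : (lam + mu) / 2 * (τ.trace / (2 * (lam + mu))) ^ 2 +
      mu * (fnorm (dev τ) / (2 * mu)) ^ 2 =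
        τ.trace ^ 2 / (8 * (lam + mu)) + fnorm (dev τ) ^ 2 / (4 * mu) := by
    field_simp
    ring
  rw [gfun, htr, hdev, hbranch, if_pos hτ, hval]
  linarith

/-- Along a ray in the region where `g` is affine, `ξ : τ - g(ξ)` grows at the rate by which `τ`
violates the Drucker–Prager constraint. -/
theorem exists_inn_sub_gfun_eq {α κ lam mu : ℝ} (hα : 0 < α) (hmu : 0 < mu) (hlm : 0 < lam + mu)
    {τ : M2} (hτ : τ.IsSymm) {x : ℝ} (hx : 0 < x) :
    ∃ ξ : M2, ξ.IsSymm ∧ inn ξ τ - gfun α κ lam mu ξ =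
      x * (fnorm (dev τ) + α * τ.trace - κ) +
        (κ * τ.trace / (4 * α * (lam + mu)) - κ ^ 2 / (8 * α ^ 2 * (lam + mu))) := by
  refine ⟨(α * x + κ / (4 * α * (lam + mu))) • (1 : M2) + (x * (fnorm (dev τ))⁻¹) • dev τ,
    isSymm_smul_one_add_smul_dev _ _ hτ, ?_⟩
  have hd := fnorm_nonneg (dev τ)
  rw [inn_smul_one_add_smul_dev, gfun, dev_smul_one_add_smul_dev, trace_smul_one_add_smul_dev,
    fnorm_smul, abs_of_nonneg (mul_nonneg hx.le (inv_nonneg.2 hd))]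
  generalize fnorm (dev τ) = d at *
  generalize τ.trace = s at *
  generalize lam + mu = K at *
  have hinv : x * d⁻¹ * d ^ 2 = x * d := by
    rcases hd.eq_or_lt with rfl | hd
    · simp
    · field_simp
  have hle : x * d⁻¹ * d ≤ x := by
    rw [mul_assoc]
    exact mul_le_of_le_one_right hx.le inv_mul_le_one
  have hnonneg : 0 ≤ x * d⁻¹ * d := by positivity
  have hbranch : 2 * α * K * (2 * (α * x + κ / (4 * α * K))) = 4 * α ^ 2 * K * x + κ := by
    field_simp
    ring
  have hpos : 0 < 4 * α ^ 2 * K * x := by positivity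
  have harg : x * d⁻¹ * d - 2 * (α * x + κ / (4 * α * K)) / (2 * α) + κ / (4 * α ^ 2 * K) =
      x * d⁻¹ * d - x := by
    field_simp
    ring
  rw [if_neg (by rw [hbranch]; nlinarith [mul_nonneg hmu.le hnonneg]), harg,
    max_eq_right (sub_nonpos.2 hle), hinv]
  field_simp
  ring

/-- The Fenchel conjugate of `g` is `τ ↦ ½ (ℂ⁻¹τ) : τ + I_K(τ)`:
for `τ ∈ K` the sup of `ξ : τ − g(ξ)` over symmetric `ξ` equals `½ (ℂ⁻¹τ) : τ`, while for
`τ ∉ K` this family is not bounded above. -/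
theorem stmt_6 (α κ lam mu : ℝ) (hα : 0 < α) (hκ : 0 < κ) (hmu : 0 < mu)
    (hlm : 0 < lam + mu) (τ : M2) (hτ : τ.IsSymm) :
    (τ ∈ Kset α κ →
      IsLUB {x : ℝ | ∃ ξ : M2, ξ.IsSymm ∧ x = inn ξ τ - gfun α κ lam mu ξ}
        ((1 / 2) * inn (Cinv lam mu τ) τ)) ∧
    (τ ∉ Kset α κ →
      ¬ BddAbove {x : ℝ | ∃ ξ : M2, ξ.IsSymm ∧ x = inn ξ τ - gfun α κ lam mu ξ}) := by
  refine ⟨fun hK => ⟨?_, fun b hb => ?_⟩, ?_⟩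
  · rintro _ ⟨ξ, -, rfl⟩
    exact inn_sub_gfun_le hα hmu hlm hK.2 ξ
  · exact hb ⟨Cinv lam mu τ, isSymm_smul_one_add_smul_dev _ _ hτ,
      (inn_Cinv_sub_gfun_Cinv hmu hlm hK.2).symm⟩
  · rintro hK ⟨b, hb⟩
    have hgap : 0 < fnorm (dev τ) + α * τ.trace - κ := by
      by_contra! h
      exact hK ⟨hτ, by linarith⟩
    set c := κ * τ.trace / (4 * α * (lam + mu)) - κ ^ 2 / (8 * α ^ 2 * (lam + mu))
    have hx : 0 < (|b - c| + 1) / (fnorm (dev τ) + α * τ.trace - κ) := by positivity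
    obtain ⟨ξ, hξ, heq⟩ := exists_inn_sub_gfun_eq (κ := κ) hα hmu hlm hτ hx
    have hle := hb ⟨ξ, hξ, rfl⟩
    rw [heq, div_mul_cancel₀ _ hgap.ne'] at hle
    linarith [le_abs_self (b - c)]
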